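/- Let N ≥ 1 and 1 ≤ k ≤ N be integers. Then B_k^{(1)} = B_k^{(2)} as ℚ-linear operators on K; that is, for every f ∈ K, (1/(q^{-1};t^{-1})_{N-k}) · M_N(-t^{k+1-N}q^{-1}) (e_k · f) = Σ_{I ⊆ {1,…,N}, |I|=k} x_I Σ_{m=0}^{N-k} Σ_{I' ⊆ I^c, |I'|=m} (q^{-m}/(t^{k+1-N}q^{-1};t)_m) · Ã_{I∪I'} · M_{I∪I'}(-t^{1-m}) f. -/

import Mathlib

open Finset MvPolynomial

set_option synthInstance.maxHeartbeats 1000000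
set_option maxHeartbeats 1000000

noncomputable section

/-- The field ℚ(q,t): fraction field of ℚ[q,t] (variables indexed by `Bool`). -/
abbrev Fqt : Type := FractionRing (MvPolynomial Bool ℚ)

/-- The polynomial ring ℚ(q,t)[x₁,…,x_N]. -/
abbrev Rx (N : ℕ) : Type := MvPolynomial (Fin N) Fqt

/-- The field K = ℚ(q,t,x₁,…,x_N), realized as the fraction field of ℚ(q,t)[x₁,…,x_N]. -/
abbrev K (N : ℕ) : Type := FractionRing (Rx N)

/-- The indeterminate q, as an element of K. -/
def qK (N : ℕ) : K N :=
  algebraMap (Rx N) (K N) (C (algebraMap (MvPolynomial Bool ℚ) Fqt (X true)))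

/-- The indeterminate t, as an element of K. -/
def tK (N : ℕ) : K N :=
  algebraMap (Rx N) (K N) (C (algebraMap (MvPolynomial Bool ℚ) Fqt (X false)))

/-- The indeterminate x_i, as an element of K. -/
def xK {N : ℕ} (i : Fin N) : K N := algebraMap (Rx N) (K N) (X i)

/-- The q-Pochhammer symbol (a;b)_n = ∏_{i=0}^{n-1} (1 - a·bⁱ). -/
def poch {F : Type*} [Field F] (a b : F) (n : ℕ) : F :=
  ∏ i ∈ Finset.range n, (1 - a * b ^ i)

/-- x_I = ∏_{i ∈ I} x_i. -/
def xProd {N : ℕ} (I : Finset (Fin N)) : K N := ∏ i ∈ I, xK i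

/-- Ã_I^J = ∏_{i ∈ I, j ∈ J∖I} (x_i − t⁻¹x_j)/(x_i − x_j). -/
def Atilde {N : ℕ} (I J : Finset (Fin N)) : K N :=
  ∏ i ∈ I, ∏ j ∈ J \ I, (xK i - (tK N)⁻¹ * xK j) / (xK i - xK j)


/-- The set {1,…,N} ∖ {1,…,ℓ}, i.e. the last N − ℓ of the N variable indices. -/
def highSet (N ℓ : ℕ) : Finset (Fin N) := Finset.univ.filter fun i => ℓ ≤ (i : ℕ)

/-- The set {1,…,ℓ}, i.e. the first ℓ of the N variable indices. -/
def lowSet (N ℓ : ℕ) : Finset (Fin N) := Finset.univ.filter fun i => (i : ℕ) < ℓ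

/-- Shortcut instance to speed up typeclass search on K. -/
noncomputable instance instKField (N : ℕ) : Field (K N) := inferInstance

/-- q as an element of the coefficient field ℚ(q,t). -/
def qF : Fqt := algebraMap (MvPolynomial Bool ℚ) Fqt (X true)

lemma qF_ne_zero : qF ≠ 0 :=
  (map_ne_zero_iff _ (IsFractionRing.injective (MvPolynomial Bool ℚ) Fqt)).mpr
    (MvPolynomial.X_ne_zero true)

/-- The simultaneous q-shift x_j ↦ q·x_j for j ∈ S, as an algebra automorphism of
ℚ(q,t)[x₁,…,x_N]. -/
def shiftAlg {N : ℕ} (S : Finset (Fin N)) : Rx N ≃ₐ[Fqt] Rx N :=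
  AlgEquiv.ofAlgHom
    (aeval fun j => if j ∈ S then C qF * X j else X j)
    (aeval fun j => if j ∈ S then C qF⁻¹ * X j else X j)
    (by
      apply algHom_ext
      intro j
      simp only [AlgHom.comp_apply, aeval_X, AlgHom.id_apply]
      by_cases h : j ∈ S
      · rw [if_pos h, map_mul, aeval_C, aeval_X, if_pos h, MvPolynomial.algebraMap_eq,
          ← mul_assoc, ← C_mul, inv_mul_cancel₀ qF_ne_zero, C_1, one_mul]
      · rw [if_neg h, aeval_X, if_neg h])
    (by
      apply algHom_ext
      intro j
      simp only [AlgHom.comp_apply, aeval_X, AlgHom.id_apply]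
      by_cases h : j ∈ S
      · rw [if_pos h, map_mul, aeval_C, aeval_X, if_pos h, MvPolynomial.algebraMap_eq,
          ← mul_assoc, ← C_mul, mul_inv_cancel₀ qF_ne_zero, C_1, one_mul]
      · rw [if_neg h, aeval_X, if_neg h])

/-- The q-shift operator ∏_{i∈S} T_{q,x_i} (x_i ↦ q·x_i for i ∈ S), as a field
automorphism of K = ℚ(q,t,x₁,…,x_N). -/
def Tshift {N : ℕ} (S : Finset (Fin N)) : K N ≃+* K N :=
  IsFractionRing.ringEquivOfRingEquiv (shiftAlg S).toRingEquiv

/-- The Macdonald operator M_J^j on K: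
M_J^j f = ∑_{S ⊆ J, |S| = j} t^{(p−j)j + j(j−1)/2} Ã_S^J (∏_{i∈S} T_{q,x_i}) f,
where p = |J|. -/
def Mop {N : ℕ} (J : Finset (Fin N)) (j : ℕ) (f : K N) : K N :=
  ∑ S ∈ powersetCard j J,
    (tK N) ^ ((J.card - j) * j + j * (j - 1) / 2) * Atilde S J * Tshift S f

/-- The generating series M_J(X) f = ∑_{j=0}^{|J|} X^j · M_J^j f. -/
def MopX {N : ℕ} (J : Finset (Fin N)) (Xpar : K N) (f : K N) : K N :=
  ∑ j ∈ Finset.range (J.card + 1), Xpar ^ j * Mop J j f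

/-- The elementary symmetric function of degree `b` in the variables `x i`, `i ∈ s`. -/
def esymmOn {ι F : Type*} [Field F] (x : ι → F) (b : ℕ) (s : Finset ι) : F :=
  ∑ I ∈ powersetCard b s, ∏ i ∈ I, x i

/-- The product `∏_{i ∈ I, j ∈ J \ I} (x i - u x j) / (x i - x j)`. -/
def crossProd {ι F : Type*} [DecidableEq ι] [Field F] (u : F) (x : ι → F) (I J : Finset ι) : F :=
  ∏ i ∈ I, ∏ j ∈ J \ I, (x i - u * x j) / (x i - x j)

/-- The Gaussian binomial coefficient in base `u`. -/
def gaussBinom {F : Type*} [Field F] (u : F) : ℕ → ℕ → F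
  | _, 0 => 1
  | 0, _ + 1 => 0
  | n + 1, l + 1 => u ^ (n - l) * gaussBinom u n l + gaussBinom u n (l + 1)

section GaussBinom

variable {F : Type*} [Field F]

lemma gaussBinom_zero_right (u : F) (n : ℕ) : gaussBinom u n 0 = 1 := by
  cases n <;> rfl

lemma gaussBinom_succ_succ (u : F) (n l : ℕ) :
    gaussBinom u (n + 1) (l + 1) = u ^ (n - l) * gaussBinom u n l + gaussBinom u n (l + 1) := rfl

lemma gaussBinom_eq_zero_of_lt (u : F) {n l : ℕ} (h : n < l) : gaussBinom u n l = 0 := by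
  induction n generalizing l with
  | zero =>
    obtain ⟨l, rfl⟩ := Nat.exists_eq_succ_of_ne_zero (by omega : l ≠ 0)
    rfl
  | succ n ih =>
    obtain ⟨l, rfl⟩ := Nat.exists_eq_succ_of_ne_zero (by omega : l ≠ 0)
    rw [Nat.succ_eq_add_one, gaussBinom_succ_succ, ih (by omega), ih (by omega)]
    ring

lemma one_sub_pow_mul_gaussBinom_succ (u : F) (n l : ℕ) :
    (1 - u ^ (l + 1)) * gaussBinom u n (l + 1) = (1 - u ^ (n - l)) * gaussBinom u n l := by
  induction n generalizing l with
  | zero => simp [gaussBinom]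
  | succ n ih =>
    cases l with
    | zero =>
      have h := ih 0
      simp only [gaussBinom_succ_succ, gaussBinom_zero_right, Nat.sub_zero] at h ⊢
      linear_combination h
    | succ l =>
      rw [gaussBinom_succ_succ u n (l + 1), gaussBinom_succ_succ u n l, Nat.succ_sub_succ]
      have h1 := ih (l + 1)
      have h2 := ih l
      by_cases hl : l + 1 ≤ n
      · obtain ⟨c, rfl⟩ := Nat.exists_eq_add_of_le hl
        rw [show l + 1 + c - (l + 1) = c by omega] at *
        rw [show l + 1 + c - l = c + 1 by omega] at *
        linear_combination h1 + u ^ (c + 1) * h2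
      · rw [gaussBinom_eq_zero_of_lt u (show n < l + 1 by omega)] at *
        rw [gaussBinom_eq_zero_of_lt u (show n < l + 1 + 1 by omega)] at *
        rw [show n - l = 0 by omega] at *
        ring

lemma one_sub_pow_mul_gaussBinom_succ_succ (u : F) (n l : ℕ) :
    (1 - u ^ (l + 1)) * gaussBinom u (n + 1) (l + 1) =
      (1 - u ^ (n + 1)) * gaussBinom u n l := by
  have h := one_sub_pow_mul_gaussBinom_succ u n l
  rw [gaussBinom_succ_succ]
  by_cases hl : l ≤ n
  · obtain ⟨c, rfl⟩ := Nat.exists_eq_add_of_le hl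
    rw [show l + c - l = c by omega] at *
    linear_combination h
  · rw [gaussBinom_eq_zero_of_lt u (show n < l by omega)] at *
    rw [gaussBinom_eq_zero_of_lt u (show n < l + 1 by omega)] at *
    ring

/-- A form of the `q`-binomial theorem: the weights `[M, l]_u z^l (z; u)_{M - l}` sum to one. -/
lemma sum_gaussBinom_mul_pow_mul_poch (u z : F) (M : ℕ) :
    ∑ l ∈ range (M + 1), gaussBinom u M l * (z ^ l * poch z u (M - l)) = 1 := by
  induction M with
  | zero => simp [gaussBinom, poch]
  | succ M ih =>
    rw [sum_range_succ']
    simp only [gaussBinom_succ_succ, gaussBinom_zero_right, Nat.succ_sub_succ, add_mul,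
      sum_add_distrib]
    have h : ∑ l ∈ range (M + 1), gaussBinom u M (l + 1) * (z ^ (l + 1) * poch z u (M - l)) +
        1 * (z ^ 0 * poch z u (M + 1 - 0)) =
        ∑ l ∈ range (M + 1), gaussBinom u M l * (z ^ l * poch z u (M + 1 - l)) := by
      rw [sum_range_succ' (fun l => gaussBinom u M l * (z ^ l * poch z u (M + 1 - l))),
        sum_range_succ, gaussBinom_eq_zero_of_lt u (Nat.lt_succ_self M)]
      simp [gaussBinom_zero_right]
    rw [add_assoc, h, ← sum_add_distrib]
    refine Eq.trans (sum_congr rfl fun l hl => ?_) ih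
    have hl' : M + 1 - l = (M - l) + 1 := by have := mem_range.mp hl; omega
    rw [hl', poch, poch, prod_range_succ]
    ring

end GaussBinom

section Symmetric

variable {ι F : Type*} [Field F]

lemma esymmOn_zero (x : ι → F) (s : Finset ι) : esymmOn x 0 s = 1 := by
  simp [esymmOn]

lemma esymmOn_eq_zero_of_card_lt (x : ι → F) {b : ℕ} {s : Finset ι} (h : s.card < b) :
    esymmOn x b s = 0 := by
  simp [esymmOn, powersetCard_eq_empty.mpr h]

lemma esymmOn_card (x : ι → F) (s : Finset ι) : esymmOn x s.card s = ∏ i ∈ s, x i := by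
  simp [esymmOn]

lemma coeff_prod_one_add_C_mul_X (x : ι → F) (b : ℕ) (s : Finset ι) :
    (∏ i ∈ s, (1 + Polynomial.C (x i) * Polynomial.X)).coeff b = esymmOn x b s := by
  classical
  rw [prod_one_add, Polynomial.finsetSum_coeff, esymmOn, powersetCard_eq_filter, sum_filter]
  refine sum_congr rfl fun I _ => ?_
  rw [prod_mul_distrib, prod_const, ← map_prod, Polynomial.coeff_C_mul_X_pow]
  simp only [eq_comm]

lemma esymmOn_union [DecidableEq ι] (x : ι → F) (k : ℕ) {s r : Finset ι} (h : Disjoint s r) :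
    esymmOn x k (s ∪ r) =
      ∑ p ∈ antidiagonal k, esymmOn x p.1 s * esymmOn x p.2 r := by
  rw [← coeff_prod_one_add_C_mul_X, prod_union h, Polynomial.coeff_mul]
  simp only [coeff_prod_one_add_C_mul_X]

lemma esymmOn_const_mul (c : F) (x : ι → F) (b : ℕ) (s : Finset ι) :
    esymmOn (fun i => c * x i) b s = c ^ b * esymmOn x b s := by
  rw [esymmOn, esymmOn, mul_sum]
  refine sum_congr rfl fun I hI => ?_
  rw [prod_mul_distrib, prod_const, (mem_powersetCard.mp hI).2]

variable [DecidableEq ι]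

lemma crossProd_singleton (u : F) (x : ι → F) (i : ι) (s : Finset ι) :
    crossProd u x {i} s = ∏ j ∈ s.erase i, (x i - u * x j) / (x i - x j) := by
  rw [crossProd, prod_singleton, sdiff_singleton_eq_erase]

/-- The Lagrange interpolation identity for `∏ (X + x j) - ∏ (X + u x j)`. -/
lemma prod_X_add_C_sub_prod_X_add_C (u : F) {x : ι → F} (hx : Function.Injective x)
    (s : Finset ι) :
    (∏ j ∈ s, (Polynomial.X + Polynomial.C (x j)) -
      ∏ j ∈ s, (Polynomial.X + Polynomial.C (u * x j)) : Polynomial F) =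
    ∑ i ∈ s, Polynomial.C ((1 - u) * (x i * crossProd u x {i} s)) *
      ∏ j ∈ s.erase i, (Polynomial.X + Polynomial.C (x j)) := by
  have hdeg (v : ι → F) (w : Finset ι) :
      (∏ j ∈ w, (Polynomial.X + Polynomial.C (v j)) : Polynomial F).degree = w.card := by
    simp [Polynomial.degree_prod]
  have hmonic (v : ι → F) :
      (∏ j ∈ s, (Polynomial.X + Polynomial.C (v j)) : Polynomial F).Monic :=
    Polynomial.monic_prod_of_monic _ _ fun j _ => Polynomial.monic_X_add_C _
  refine Polynomial.eq_of_degrees_lt_of_eval_index_eq (v := fun i => -x i) s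
    (fun a _ b _ h => hx (neg_injective h)) ?_ ?_ ?_
  · rw [← hdeg x s]
    exact Polynomial.degree_sub_lt_left (by rw [hdeg, hdeg]) (hmonic x).ne_zero
      (by rw [(hmonic _).leadingCoeff, (hmonic _).leadingCoeff])
  · refine (Polynomial.degree_sum_le _ _).trans_lt ?_
    rw [Finset.sup_lt_iff (by exact WithBot.bot_lt_coe _)]
    intro i hi
    refine ((Polynomial.degree_mul_le _ _).trans
      (add_le_add_left Polynomial.degree_C_le _)).trans_lt ?_
    rw [hdeg, zero_add]
    exact_mod_cast card_erase_lt_of_mem hi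
  · intro i hi
    rw [Polynomial.eval_sub, Polynomial.eval_finsetSum, Polynomial.eval_prod,
      Polynomial.eval_prod, prod_eq_zero hi (by simp), sum_eq_single_of_mem i hi]
    · simp only [Polynomial.eval_mul, Polynomial.eval_C, Polynomial.eval_prod,
        Polynomial.eval_add, Polynomial.eval_X]
      rw [← mul_prod_erase s _ hi, crossProd_singleton, mul_assoc, mul_assoc, ← prod_mul_distrib]
      have : ∏ j ∈ s.erase i, (x i - u * x j) / (x i - x j) * (-x i + x j) =
          ∏ j ∈ s.erase i, (-x i + u * x j) := by
        refine prod_congr rfl fun j hj => ?_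
        have hne : x i - x j ≠ 0 := sub_ne_zero.mpr fun h => ne_of_mem_erase hj (hx h).symm
        field_simp
        ring
      rw [this]
      ring
    · intro j hj hji
      rw [Polynomial.eval_mul, Polynomial.eval_prod,
        prod_eq_zero (mem_erase.mpr ⟨hji.symm, hi⟩) (by simp), mul_zero]

lemma sum_mul_crossProd_singleton_mul_esymmOn (u : F) {x : ι → F} (hx : Function.Injective x)
    (b : ℕ) (s : Finset ι) :
    (1 - u) * ∑ i ∈ s, x i * crossProd u x {i} s * esymmOn x b (s.erase i) =
      (1 - u ^ (b + 1)) * esymmOn x (b + 1) s := by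
  by_cases hb : b + 1 ≤ s.card
  · have h := congrArg (fun p => p.coeff (s.card - (b + 1)))
      (prod_X_add_C_sub_prod_X_add_C u hx s)
    simp only [Polynomial.coeff_sub, Polynomial.finsetSum_coeff, Polynomial.coeff_C_mul] at h
    rw [Finset.prod_X_add_C_coeff _ _ (Nat.sub_le _ _), Finset.prod_X_add_C_coeff _ _ (Nat.sub_le _ _),
      Nat.sub_sub_self hb] at h
    change esymmOn x (b + 1) s - esymmOn (fun i => u * x i) (b + 1) s = _ at h
    rw [esymmOn_const_mul] at h
    rw [sub_mul _ _ (esymmOn _ _ _), one_mul, h, mul_sum]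
    refine sum_congr rfl fun i hi => ?_
    have hc := card_erase_of_mem hi
    rw [Finset.prod_X_add_C_coeff _ _ (by omega), esymmOn,
      show (s.erase i).card - (s.card - (b + 1)) = b by omega]
    ring
  · rw [esymmOn_eq_zero_of_card_lt x (show s.card < b + 1 by omega), sum_eq_zero, mul_zero,
      mul_zero]
    intro i hi
    have hc := card_erase_of_mem hi
    have := card_pos.mpr ⟨i, hi⟩
    rw [esymmOn_eq_zero_of_card_lt x (show (s.erase i).card < b by omega), mul_zero]

lemma sum_crossProd_singleton (u : F) {x : ι → F} (hx : Function.Injective x)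
    (hx0 : ∀ i, x i ≠ 0) (s : Finset ι) :
    (1 - u) * ∑ i ∈ s, crossProd u x {i} s = 1 - u ^ s.card := by
  rcases s.eq_empty_or_nonempty with rfl | hs
  · simp
  · obtain ⟨n, hn⟩ := Nat.exists_eq_succ_of_ne_zero (card_pos.mpr hs).ne'
    have h := sum_mul_crossProd_singleton_mul_esymmOn u hx n s
    rw [Nat.succ_eq_add_one] at hn
    rw [← hn, esymmOn_card] at h
    refine mul_right_cancel₀ (prod_ne_zero_iff.mpr fun i (_ : i ∈ s) => hx0 i) (Eq.trans ?_ h)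
    rw [mul_assoc, sum_mul]
    congr 1
    refine sum_congr rfl fun i hi => ?_
    have hc : (s.erase i).card = n := by rw [card_erase_of_mem hi, hn]; rfl
    rw [← hc, esymmOn_card, ← mul_prod_erase s _ hi]
    ring

lemma crossProd_singleton_mul_crossProd_insert (u : F) (x : ι → F) {i : ι} {r s : Finset ι}
    (hr : r ⊆ s.erase i) :
    crossProd u x {i} (insert i r) * crossProd u x (insert i r) s =
      crossProd u x {i} s * crossProd u x r (s.erase i) := by
  have hir : i ∉ r := fun h => notMem_erase i s (hr h)
  have h1 : s \ insert i r = s.erase i \ r := by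
    ext j; simp only [mem_sdiff, mem_insert, mem_erase]; tauto
  rw [crossProd_singleton, crossProd_singleton, erase_insert hir, crossProd, crossProd,
    prod_insert hir, h1, ← mul_assoc]
  congr 1
  rw [mul_comm, prod_sdiff hr]

lemma sum_powersetCard_succ_sum_mem {M : Type*} [AddCommMonoid M] (φ : ι → Finset ι → M)
    (r : ℕ) (s : Finset ι) :
    ∑ R ∈ powersetCard (r + 1) s, ∑ i ∈ R, φ i R =
      ∑ i ∈ s, ∑ R ∈ powersetCard r (s.erase i), φ i (insert i R) := by
  rw [sum_sigma', sum_sigma']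
  refine sum_bij' (fun p _ => ⟨p.2, p.1.erase p.2⟩) (fun p _ => ⟨insert p.1 p.2, p.1⟩)
    ?_ ?_ ?_ ?_ ?_
  · rintro ⟨R, i⟩ h
    simp only [mem_sigma, mem_powersetCard] at h ⊢
    refine ⟨h.1.1 h.2, erase_subset_erase _ h.1.1, ?_⟩
    rw [card_erase_of_mem h.2, h.1.2]; rfl
  · rintro ⟨i, R⟩ h
    simp only [mem_sigma, mem_powersetCard] at h ⊢
    have hi : i ∉ R := fun h' => notMem_erase i s (h.2.1 h')
    exact ⟨⟨insert_subset h.1 (h.2.1.trans (erase_subset _ _)), by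
      rw [card_insert_of_notMem hi, h.2.2]⟩, mem_insert_self _ _⟩
  · rintro ⟨R, i⟩ h
    simp only [mem_sigma] at h
    simp [insert_erase h.2]
  · rintro ⟨i, R⟩ h
    simp only [mem_sigma, mem_powersetCard] at h ⊢
    have hi : i ∉ R := fun h' => notMem_erase i s (h.2.1 h')
    simp [erase_insert hi]
  · rintro ⟨R, i⟩ h
    simp only [mem_sigma] at h
    simp [insert_erase h.2]

lemma sum_crossProd (u : F) (hu : ∀ n : ℕ, u ^ (n + 1) ≠ 1) {x : ι → F}
    (hx : Function.Injective x) (hx0 : ∀ i, x i ≠ 0) (r : ℕ) (s : Finset ι) :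
    ∑ R ∈ powersetCard r s, crossProd u x R s = gaussBinom u s.card r := by
  induction r generalizing s with
  | zero => simp [crossProd, gaussBinom_zero_right]
  | succ r ih =>
    refine mul_left_cancel₀ (sub_ne_zero.mpr (hu r).symm) ?_
    have h1 : (1 - u ^ (r + 1)) * ∑ R ∈ powersetCard (r + 1) s, crossProd u x R s =
        (1 - u) * ∑ R ∈ powersetCard (r + 1) s, ∑ i ∈ R,
          crossProd u x {i} R * crossProd u x R s := by
      rw [mul_sum, mul_sum]
      refine sum_congr rfl fun R hR => ?_
      rw [← sum_mul, ← mul_assoc, sum_crossProd_singleton u hx hx0, (mem_powersetCard.mp hR).2]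
    rw [h1, sum_powersetCard_succ_sum_mem]
    rcases hn : s.card with _ | n
    · rw [card_eq_zero.mp hn]
      simp [gaussBinom]
    have h2 : ∀ i ∈ s, ∑ R ∈ powersetCard r (s.erase i),
        crossProd u x {i} (insert i R) * crossProd u x (insert i R) s =
          crossProd u x {i} s * gaussBinom u n r := by
      intro i hi
      rw [sum_congr rfl fun R hR =>
        crossProd_singleton_mul_crossProd_insert u x (mem_powersetCard.mp hR).1, ← mul_sum, ih,
        card_erase_of_mem hi, hn]
      rfl
    rw [sum_congr rfl h2, ← sum_mul, ← mul_assoc, sum_crossProd_singleton u hx hx0, hn,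
      one_sub_pow_mul_gaussBinom_succ_succ]

/-- Summing `esymmOn x b R` against `crossProd u x R s` over the subsets `R` of a fixed size
gives a multiple of `esymmOn x b s`. -/
lemma sum_crossProd_mul_esymmOn (u : F) (hu : ∀ n : ℕ, u ^ (n + 1) ≠ 1) {x : ι → F}
    (hx : Function.Injective x) (hx0 : ∀ i, x i ≠ 0) (b l : ℕ) (s : Finset ι) :
    ∑ R ∈ powersetCard (b + l) s, crossProd u x R s * esymmOn x b R =
      gaussBinom u (s.card - b) l * esymmOn x b s := by
  induction b generalizing s with
  | zero => simp [esymmOn_zero, sum_crossProd u hu hx hx0]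
  | succ b ih =>
    refine mul_left_cancel₀ (sub_ne_zero.mpr (hu b).symm) ?_
    have h1 : (1 - u ^ (b + 1)) *
        ∑ R ∈ powersetCard (b + 1 + l) s, crossProd u x R s * esymmOn x (b + 1) R =
        (1 - u) * ∑ R ∈ powersetCard (b + l + 1) s, ∑ i ∈ R,
          (crossProd u x {i} R * crossProd u x R s) * (x i * esymmOn x b (R.erase i)) := by
      rw [mul_sum, mul_sum, add_right_comm]
      refine sum_congr rfl fun R _ => ?_
      rw [mul_left_comm, ← sum_mul_crossProd_singleton_mul_esymmOn u hx, mul_left_comm, mul_sum]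
      congr 1
      exact sum_congr rfl fun i _ => by ring
    rw [h1, sum_powersetCard_succ_sum_mem]
    have h2 : ∀ i ∈ s, ∑ R ∈ powersetCard (b + l) (s.erase i),
        (crossProd u x {i} (insert i R) * crossProd u x (insert i R) s) *
          (x i * esymmOn x b ((insert i R).erase i)) =
        gaussBinom u (s.card - (b + 1)) l *
          (x i * crossProd u x {i} s * esymmOn x b (s.erase i)) := by
      intro i hi
      have hc : (s.erase i).card - b = s.card - (b + 1) := by
        rw [card_erase_of_mem hi]; omega
      rw [← hc, mul_left_comm, ← ih, mul_sum]
      refine sum_congr rfl fun R hR => ?_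
      have hR' := (mem_powersetCard.mp hR).1
      rw [crossProd_singleton_mul_crossProd_insert u x hR',
        erase_insert fun h => notMem_erase i s (hR' h)]
      ring
    rw [sum_congr rfl h2, ← mul_sum, mul_left_comm, sum_mul_crossProd_singleton_mul_esymmOn u hx,
      mul_left_comm]

end Symmetric

section SubsetSums

variable {ι F : Type*} [Field F] [DecidableEq ι]

lemma sum_powerset_crossProd_mul_esymmOn (u z : F) (hu : ∀ n : ℕ, u ^ (n + 1) ≠ 1) {x : ι → F}
    (hx : Function.Injective x) (hx0 : ∀ i, x i ≠ 0) (b : ℕ) (s : Finset ι) :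
    ∑ R ∈ s.powerset, crossProd u x R s * esymmOn x b R *
      (z ^ (R.card - b) * poch z u (s.card - R.card)) = esymmOn x b s := by
  by_cases hb : b ≤ s.card
  · obtain ⟨M, hM⟩ := Nat.exists_eq_add_of_le hb
    rw [sum_powerset, hM, add_assoc, sum_range_add, sum_eq_zero, zero_add]
    · have h (l : ℕ) : ∑ R ∈ powersetCard (b + l) s, crossProd u x R s * esymmOn x b R *
          (z ^ (R.card - b) * poch z u (b + M - R.card)) =
          esymmOn x b s * (gaussBinom u M l * (z ^ l * poch z u (M - l))) := by
        have hc : s.card - b = M := by omega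
        rw [← mul_assoc (esymmOn x b s), mul_comm (esymmOn x b s), ← hc,
          ← sum_crossProd_mul_esymmOn u hu hx hx0, sum_mul]
        refine sum_congr rfl fun R hR => ?_
        rw [(mem_powersetCard.mp hR).2, Nat.add_sub_cancel_left, hc, Nat.add_sub_add_left]
      rw [sum_congr rfl fun l _ => h l, ← mul_sum, sum_gaussBinom_mul_pow_mul_poch, mul_one]
    · intro r hr
      refine sum_eq_zero fun R hR => ?_
      rw [esymmOn_eq_zero_of_card_lt x (by
        rw [(mem_powersetCard.mp hR).2]; exact mem_range.mp hr)]
      ring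
  · rw [esymmOn_eq_zero_of_card_lt x (not_le.mp hb)]
    refine sum_eq_zero fun R hR => ?_
    rw [esymmOn_eq_zero_of_card_lt x ((card_le_card (mem_powerset.mp hR)).trans_lt (not_le.mp hb))]
    ring

lemma poch_mul_poch_inv {t : F} (ht : t ≠ 0) (z : F) {L m : ℕ} (h : m ≤ L) :
    poch (t ^ (1 - (L : ℤ)) * z) t m * poch z t⁻¹ (L - m) = poch z t⁻¹ L := by
  induction m with
  | zero => simp [poch]
  | succ m ih =>
    rw [← ih (by omega), show L - m = L - (m + 1) + 1 by omega]
    simp only [poch, prod_range_succ]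
    have : t ^ (1 - (L : ℤ)) * z * t ^ m = z * t⁻¹ ^ (L - (m + 1)) := by
      rw [mul_right_comm, mul_comm z, ← zpow_natCast, ← zpow_natCast, inv_zpow', ← zpow_add₀ ht]
      congr 2
      omega
    rw [this]
    ring

lemma crossProd_union_mul_crossProd (u : F) (x : ι → F) {S R U : Finset ι}
    (hR : R ⊆ U \ S) :
    crossProd u x (S ∪ R) U * crossProd u x S (S ∪ R) =
      crossProd u x S U * crossProd u x R (U \ S) := by
  have hd : Disjoint S R := disjoint_of_subset_right hR disjoint_sdiff
  have h1 : (S ∪ R) \ S = R := by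
    rw [union_sdiff_left, sdiff_eq_self_of_disjoint hd.symm]
  have h2 : U \ (S ∪ R) = (U \ S) \ R := by rw [sdiff_sdiff_left]; rfl
  simp only [crossProd]
  rw [prod_union hd, h1, h2, mul_right_comm, ← prod_mul_distrib]
  congr 1
  exact prod_congr rfl fun i _ => prod_sdiff hR

lemma sum_powerset_filter_superset {M : Type*} [AddCommMonoid M] {U I : Finset ι} (hI : I ⊆ U)
    (Φ : Finset ι → M) :
    ∑ R ∈ (U \ I).powerset, Φ (I ∪ R) = ∑ J ∈ U.powerset with I ⊆ J, Φ J := by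
  refine sum_bij' (fun R _ => I ∪ R) (fun J _ => J \ I) ?_ ?_ ?_ ?_ fun _ _ => rfl
  · intro R hR
    simp only [mem_filter, mem_powerset] at hR ⊢
    exact ⟨union_subset hI (hR.trans sdiff_subset), subset_union_left⟩
  · intro J hJ
    simp only [mem_filter, mem_powerset] at hJ ⊢
    exact sdiff_subset_sdiff hJ.1 subset_rfl
  · intro R hR
    have hd : Disjoint I R := disjoint_of_subset_right (mem_powerset.mp hR) disjoint_sdiff
    rw [union_sdiff_left, sdiff_eq_self_of_disjoint hd.symm]
  · intro J hJ
    exact union_sdiff_of_subset (mem_filter.mp hJ).2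

lemma sum_powersetCard_mul_sum_powersetCard (x : ι → F) {k : ℕ} (U : Finset ι)
    (Φ : ℕ → Finset ι → F) :
    ∑ I ∈ powersetCard k U, (∏ i ∈ I, x i) *
      ∑ m ∈ range (U.card - k + 1), ∑ I' ∈ powersetCard m (U \ I), Φ m (I ∪ I') =
    ∑ J ∈ U.powerset, esymmOn x k J * Φ (J.card - k) J := by
  have h : ∀ I ∈ powersetCard k U, (∏ i ∈ I, x i) *
      ∑ m ∈ range (U.card - k + 1), ∑ I' ∈ powersetCard m (U \ I), Φ m (I ∪ I') =
      ∑ J ∈ U.powerset with I ⊆ J, (∏ i ∈ I, x i) * Φ (J.card - k) J := by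
    intro I hI
    obtain ⟨hIU, hIk⟩ := mem_powersetCard.mp hI
    rw [← mul_sum, ← sum_powerset_filter_superset hIU (fun J => Φ (J.card - k) J), sum_powerset,
      card_sdiff_of_subset hIU, hIk]
    congr 1
    refine sum_congr rfl fun m _ => sum_congr rfl fun I' hI' => ?_
    obtain ⟨hs, hc⟩ := mem_powersetCard.mp hI'
    rw [card_union_of_disjoint (disjoint_of_subset_right hs disjoint_sdiff), hIk, hc,
      Nat.add_sub_cancel_left]
  rw [sum_congr rfl h, sum_comm' (t' := U.powerset) (s' := fun J => powersetCard k J)]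
  · exact sum_congr rfl fun J _ => (sum_mul _ _ _).symm
  · intro I J
    simp only [mem_powersetCard, mem_filter, mem_powerset]
    constructor
    · rintro ⟨⟨_, hk⟩, hJ, hIJ⟩
      exact ⟨⟨hIJ, hk⟩, hJ⟩
    · rintro ⟨⟨hIJ, hk⟩, hJ⟩
      exact ⟨⟨hIJ.trans hJ, hk⟩, hJ, hIJ⟩

lemma sum_powerset_sum_powerset {M : Type*} [AddCommMonoid M] (U : Finset ι)
    (Θ : Finset ι → Finset ι → M) :
    ∑ J ∈ U.powerset, ∑ S ∈ J.powerset, Θ S J =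
      ∑ S ∈ U.powerset, ∑ R ∈ (U \ S).powerset, Θ S (S ∪ R) := by
  rw [sum_comm' (t' := U.powerset) (s' := fun S => {J ∈ U.powerset | S ⊆ J})]
  · exact sum_congr rfl fun S hS =>
      (sum_powerset_filter_superset (mem_powerset.mp hS) (Θ S)).symm
  · intro J S
    simp only [mem_filter, mem_powerset]
    constructor
    · rintro ⟨hJ, hS⟩
      exact ⟨⟨hJ, hS⟩, hS.trans hJ⟩
    · rintro ⟨⟨hJ, hS⟩, _⟩
      exact ⟨hJ, hS⟩

lemma esymmOn_shift (q : F) (x : ι → F) (k : ℕ) {S U : Finset ι} (hS : S ⊆ U) :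
    esymmOn (fun i => if i ∈ S then q * x i else x i) k U =
      ∑ p ∈ antidiagonal k, q ^ p.1 * esymmOn x p.1 S * esymmOn x p.2 (U \ S) := by
  conv_lhs => rw [← union_sdiff_of_subset hS]
  rw [esymmOn_union _ _ disjoint_sdiff]
  refine sum_congr rfl fun p _ => ?_
  congr 1
  · rw [← esymmOn_const_mul]
    exact sum_congr rfl fun I hI => prod_congr rfl fun i hi =>
      if_pos ((mem_powersetCard.mp hI).1 hi)
  · exact sum_congr rfl fun I hI => prod_congr rfl fun i hi =>
      if_neg (mem_sdiff.mp ((mem_powersetCard.mp hI).1 hi)).2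

/-- The coefficient identity obtained by comparing the terms `T_S f` on both sides. -/
lemma shifted_esymmOn_eq_sum {q t : F} (hq : q ≠ 0) (ht : t ≠ 0)
    (hu : ∀ n : ℕ, t⁻¹ ^ (n + 1) ≠ 1) (hz : ∀ n, poch q⁻¹ t⁻¹ n ≠ 0) {x : ι → F}
    (hx : Function.Injective x) (hx0 : ∀ i, x i ≠ 0) {k : ℕ} {S U : Finset ι} (hS : S ⊆ U)
    (hk : k ≤ U.card) :
    (poch q⁻¹ t⁻¹ (U.card - k))⁻¹ * (q⁻¹ ^ S.card *
      esymmOn (fun i => if i ∈ S then q * x i else x i) k U) =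
    ∑ R ∈ (U \ S).powerset, crossProd t⁻¹ x R (U \ S) * esymmOn x k (S ∪ R) *
      (q⁻¹ ^ ((S ∪ R).card - k) /
        poch (t ^ ((k : ℤ) + 1 - U.card) * q⁻¹) t ((S ∪ R).card - k)) := by
  have hexp : (k : ℤ) + 1 - U.card = 1 - ((U.card - k : ℕ) : ℤ) := by omega
  have hCcard : (U \ S).card = U.card - S.card := card_sdiff_of_subset hS
  have hScard := card_le_card hS
  have hdisj : ∀ R ∈ (U \ S).powerset, Disjoint S R := fun R hR =>
    disjoint_of_subset_right (mem_powerset.mp hR) disjoint_sdiff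
  rw [esymmOn_shift q x k hS, mul_sum, mul_sum]
  have h : ∀ R ∈ (U \ S).powerset, crossProd t⁻¹ x R (U \ S) * esymmOn x k (S ∪ R) *
      (q⁻¹ ^ ((S ∪ R).card - k) /
        poch (t ^ ((k : ℤ) + 1 - U.card) * q⁻¹) t ((S ∪ R).card - k)) =
      ∑ p ∈ antidiagonal k, (poch q⁻¹ t⁻¹ (U.card - k))⁻¹ *
        (q⁻¹ ^ S.card * q ^ p.1 * esymmOn x p.1 S *
          (crossProd t⁻¹ x R (U \ S) * esymmOn x p.2 R *
            (q⁻¹ ^ (R.card - p.2) * poch q⁻¹ t⁻¹ ((U \ S).card - R.card)))) := by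
    intro R hR
    rw [esymmOn_union x k (hdisj R hR), mul_sum, sum_mul]
    refine sum_congr rfl fun p hp => ?_
    have hpk := mem_antidiagonal.mp hp
    by_cases ha : p.1 ≤ S.card
    swap
    · rw [esymmOn_eq_zero_of_card_lt x (not_le.mp ha)]
      ring
    by_cases hb : p.2 ≤ R.card
    swap
    · rw [esymmOn_eq_zero_of_card_lt x (not_le.mp hb)]
      ring
    have hRC := card_le_card (mem_powerset.mp hR)
    rw [card_union_of_disjoint (hdisj R hR)]
    have hm : S.card + R.card - k ≤ U.card - k := by omega
    have hpoch := poch_mul_poch_inv ht q⁻¹ hm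
    rw [← hexp, show U.card - k - (S.card + R.card - k) = (U \ S).card - R.card by omega] at hpoch
    have h0 := hz (U.card - k)
    rw [← hpoch] at h0 ⊢
    have h1 := left_ne_zero_of_mul h0
    have h2 := right_ne_zero_of_mul h0
    have hqq : q⁻¹ ^ S.card * q ^ p.1 = q⁻¹ ^ (S.card - p.1) := by
      rw [← Nat.sub_add_cancel ha, pow_add, Nat.add_sub_cancel, mul_assoc, ← mul_pow,
        inv_mul_cancel₀ hq, one_pow, mul_one]
    rw [hqq, show S.card + R.card - k = (S.card - p.1) + (R.card - p.2) by omega, pow_add]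
    rw [show S.card + R.card - k = (S.card - p.1) + (R.card - p.2) by omega] at h1
    generalize poch q⁻¹ t⁻¹ ((U \ S).card - R.card) = a at *
    generalize poch (t ^ ((k : ℤ) + 1 - U.card) * q⁻¹) t _ = c at *
    generalize q⁻¹ ^ (S.card - p.1) = d
    generalize q⁻¹ ^ (R.card - p.2) = e
    field_simp
  rw [sum_congr rfl h, sum_comm]
  refine sum_congr rfl fun p _ => ?_
  rw [← mul_sum, ← mul_sum, sum_powerset_crossProd_mul_esymmOn _ _ hu hx hx0]
  ring

end SubsetSums

section RationalFunctions

variable {N : ℕ}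

lemma algebraMap_C_comp_injective (N : ℕ) :
    Function.Injective fun p : MvPolynomial Bool ℚ =>
      algebraMap (Rx N) (K N) (C (algebraMap (MvPolynomial Bool ℚ) Fqt p)) :=
  (IsFractionRing.injective (Rx N) (K N)).comp
    ((C_injective (Fin N) Fqt).comp (IsFractionRing.injective (MvPolynomial Bool ℚ) Fqt))

lemma qK_ne_zero (N : ℕ) : qK N ≠ 0 := by
  intro h
  refine X_ne_zero (R := ℚ) true (algebraMap_C_comp_injective N (h.trans ?_))
  simp only [map_zero]

lemma tK_ne_zero (N : ℕ) : tK N ≠ 0 := by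
  intro h
  refine X_ne_zero (R := ℚ) false (algebraMap_C_comp_injective N (h.trans ?_))
  simp only [map_zero]

lemma qK_pow_mul_tK_pow_ne_one (N : ℕ) {a b : ℕ} (h : a + b ≠ 0) :
    qK N ^ a * tK N ^ b ≠ 1 := by
  intro h1
  have h2 : (X true ^ a * X false ^ b : MvPolynomial Bool ℚ) = 1 := by
    refine algebraMap_C_comp_injective N ?_
    simp only [map_mul, map_pow, map_one]
    exact h1
  have h3 := congrArg (MvPolynomial.eval fun _ => (0 : ℚ)) h2
  simp only [map_mul, map_pow, eval_X, map_one, ← pow_add, zero_pow h] at h3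
  exact zero_ne_one h3

lemma poch_inv_qK_inv_tK_ne_zero (N n : ℕ) : poch (qK N)⁻¹ (tK N)⁻¹ n ≠ 0 := by
  refine prod_ne_zero_iff.mpr fun i _ h => ?_
  refine qK_pow_mul_tK_pow_ne_one N (a := 1) (b := i) (by omega) ?_
  rw [sub_eq_zero, inv_pow, ← mul_inv] at h
  rw [pow_one, ← inv_inv (qK N * tK N ^ i), ← h, inv_one]

lemma xK_injective : Function.Injective (xK (N := N)) :=
  (IsFractionRing.injective (Rx N) (K N)).comp X_injective

lemma xK_ne_zero (i : Fin N) : xK i ≠ 0 :=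
  (map_ne_zero_iff _ (IsFractionRing.injective (Rx N) (K N))).mpr (X_ne_zero i)

lemma Tshift_xK (S : Finset (Fin N)) (i : Fin N) :
    Tshift S (xK i) = if i ∈ S then qK N * xK i else xK i := by
  have h : (shiftAlg S).toRingEquiv (X i : Rx N) = if i ∈ S then C qF * X i else X i :=
    aeval_X _ _
  rw [Tshift, xK, IsFractionRing.ringEquivOfRingEquiv_algebraMap, h]
  split_ifs
  · rw [map_mul]
    rfl
  · rfl

lemma Tshift_esymmOn (S U : Finset (Fin N)) (k : ℕ) :
    Tshift S (esymmOn xK k U) =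
      esymmOn (fun i => if i ∈ S then qK N * xK i else xK i) k U := by
  simp only [esymmOn, map_sum, map_prod, Tshift_xK]

lemma MopX_eq_sum_powerset (J : Finset (Fin N)) (Xpar f : K N) :
    MopX J Xpar f = ∑ S ∈ J.powerset, Xpar ^ S.card *
      (tK N ^ ((J.card - S.card) * S.card + S.card * (S.card - 1) / 2) * Atilde S J *
        Tshift S f) := by
  rw [sum_powerset, MopX]
  refine sum_congr rfl fun j _ => ?_
  rw [Mop, mul_sum]
  refine sum_congr rfl fun S hS => ?_
  rw [(mem_powersetCard.mp hS).2]

end RationalFunctions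

/-!
Statement 0 (B_k^{(1)} = B_k^{(2)}): for 1 ≤ k ≤ N and every f ∈ K,
  (1/(q^{-1};t^{-1})_{N−k}) · M_N(−t^{k+1−N}q^{-1}) (e_k · f)
  = ∑_{|I|=k} x_I ∑_{m=0}^{N−k} ∑_{I'⊆Iᶜ, |I'|=m}
      (q^{-m}/(t^{k+1−N}q^{-1};t)_m) · Ã_{I∪I'} · M_{I∪I'}(−t^{1−m}) f.
-/

theorem stmt0 (N k : ℕ) (hN : 1 ≤ N) (hk : 1 ≤ k) (hkN : k ≤ N) (f : K N) :
    (poch (qK N)⁻¹ (tK N)⁻¹ (N - k))⁻¹ *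
      MopX (univ : Finset (Fin N)) (-(tK N) ^ ((k : ℤ) + 1 - N) * (qK N)⁻¹)
        ((∑ I ∈ powersetCard k (univ : Finset (Fin N)), xProd I) * f)
    = ∑ I ∈ powersetCard k (univ : Finset (Fin N)),
        xProd I *
          ∑ m ∈ Finset.range (N - k + 1),
            ∑ I' ∈ powersetCard m Iᶜ,
              (qK N)⁻¹ ^ m / poch ((tK N) ^ ((k : ℤ) + 1 - N) * (qK N)⁻¹) (tK N) m *
                (Atilde (I ∪ I') univ * MopX (I ∪ I') (-(tK N) ^ (1 - (m : ℤ))) f) := by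
  have hu (n : ℕ) : (tK N)⁻¹ ^ (n + 1) ≠ 1 := fun h => by
    refine qK_pow_mul_tK_pow_ne_one N (a := 0) (b := n + 1) (by omega) ?_
    rw [pow_zero, one_mul, ← inv_inj, ← inv_pow, h, inv_one]
  have hcard : (univ : Finset (Fin N)).card = N := by simp
  have hr := sum_powersetCard_mul_sum_powersetCard (xK (N := N)) (k := k) univ fun m J =>
    (qK N)⁻¹ ^ m / poch ((tK N) ^ ((k : ℤ) + 1 - N) * (qK N)⁻¹) (tK N) m *
      (Atilde J univ * MopX J (-(tK N) ^ (1 - (m : ℤ))) f)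
  rw [hcard] at hr
  simp only [compl_eq_univ_sdiff]
  refine Eq.trans ?_ hr.symm
  change (poch (qK N)⁻¹ (tK N)⁻¹ (N - k))⁻¹ *
    MopX univ (-(tK N) ^ ((k : ℤ) + 1 - N) * (qK N)⁻¹) (esymmOn xK k univ * f) = _
  simp only [MopX_eq_sum_powerset, mul_sum]
  rw [sum_powerset_sum_powerset]
  refine sum_congr rfl fun S _ => ?_
  have hS := shifted_esymmOn_eq_sum (qK_ne_zero N) (tK_ne_zero N) hu
    (poch_inv_qK_inv_tK_ne_zero N) xK_injective xK_ne_zero (subset_univ S)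
    (hkN.trans_eq hcard.symm)
  rw [hcard] at hS
  have hSN : S.card ≤ N := (card_le_univ S).trans_eq (Fintype.card_fin N)
  rw [map_mul, Tshift_esymmOn, hcard]
  have hX : (-(tK N) ^ ((k : ℤ) + 1 - N) * (qK N)⁻¹) ^ S.card *
      tK N ^ ((N - S.card) * S.card + S.card * (S.card - 1) / 2) =
      (qK N)⁻¹ ^ S.card * ((-tK N ^ ((k : ℤ) + 1 - S.card)) ^ S.card *
        tK N ^ (S.card * (S.card - 1) / 2)) := by
    have h1 : (tK N) ^ ((k : ℤ) + 1 - S.card) =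
        (tK N) ^ ((k : ℤ) + 1 - N) * tK N ^ (N - S.card) := by
      rw [← zpow_natCast (tK N) (N - S.card), ← zpow_add₀ (tK_ne_zero N)]
      congr 1
      omega
    rw [h1, pow_add, pow_mul, ← neg_mul, mul_pow, mul_pow]
    ring
  calc _ = (poch (qK N)⁻¹ (tK N)⁻¹ (N - k))⁻¹ * ((qK N)⁻¹ ^ S.card *
        esymmOn (fun i => if i ∈ S then qK N * xK i else xK i) k univ) *
        ((-tK N ^ ((k : ℤ) + 1 - S.card)) ^ S.card * tK N ^ (S.card * (S.card - 1) / 2) *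
          (Atilde S univ * Tshift S f)) := by
        linear_combination (poch (qK N)⁻¹ (tK N)⁻¹ (N - k))⁻¹ *
          esymmOn (fun i => if i ∈ S then qK N * xK i else xK i) k univ *
          (Atilde S univ * Tshift S f) * hX
    _ = _ := by
        rw [hS, sum_mul]
        refine sum_congr rfl fun R hR => ?_
        have hR' := mem_powerset.mp hR
        have hA : Atilde (S ∪ R) univ * Atilde S (S ∪ R) =
            Atilde S univ * crossProd (tK N)⁻¹ xK R (univ \ S) :=
          crossProd_union_mul_crossProd (tK N)⁻¹ xK hR'
        have hc : (S ∪ R).card = S.card + R.card :=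
          card_union_of_disjoint (disjoint_of_subset_right hR' disjoint_sdiff)
        by_cases hk' : k ≤ S.card + R.card
        · have h1 : (tK N) ^ ((k : ℤ) + 1 - S.card) =
              (tK N) ^ (1 - (((S ∪ R).card - k : ℕ) : ℤ)) *
                tK N ^ ((S ∪ R).card - S.card) := by
            rw [← zpow_natCast (tK N) ((S ∪ R).card - S.card), ← zpow_add₀ (tK_ne_zero N)]
            congr 1
            omega
          rw [h1, pow_add, pow_mul, ← neg_mul, mul_pow]
          linear_combination (- esymmOn xK k (S ∪ R) * ((qK N)⁻¹ ^ ((S ∪ R).card - k) /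
            poch (tK N ^ ((k : ℤ) + 1 - N) * (qK N)⁻¹) (tK N) ((S ∪ R).card - k)) *
            ((-tK N ^ (1 - (((S ∪ R).card - k : ℕ) : ℤ))) ^ S.card *
              (tK N ^ ((S ∪ R).card - S.card)) ^ S.card * tK N ^ (S.card * (S.card - 1) / 2) *
              Tshift S f)) * hA
        · rw [esymmOn_eq_zero_of_card_lt xK (show (S ∪ R).card < k by omega)]
          ring

end
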